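/- Let V be a real vector space of dimension 2m (with m ≥ 1) and let ω be a nondegenerate alternating bilinear form on V, regarded as an element of Λ²V*. Then for every integer k with 0 ≤ k ≤ m, the linear map Λ^k V* → Λ^{2m-k} V* given by α ↦ ω^{m-k} ∧ α (exterior multiplication by the (m-k)-th exterior power of ω) is a linear isomorphism. -/

import Mathlib

/-- The alternating `2`-form `(φ, ψ) ↦ φ(v)ψ(w) - ψ(v)φ(w)` on the dual space, used to
evaluate elements of `Λ² V*` against a pair of vectors `v, w ∈ V`. -/
noncomputable def evalPair {V : Type*} [AddCommGroup V] [Module ℝ V] (v w : V) :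
    (Module.Dual ℝ V) [⋀^Fin 2]→ₗ[ℝ] ℝ :=
  MultilinearMap.alternatization
    ((MultilinearMap.mkPiAlgebra ℝ (Fin 2) ℝ).compLinearMap
      ![Module.Dual.eval ℝ V v, Module.Dual.eval ℝ V w])

/-- Evaluation of an element of the exterior algebra of `V*` (thought of in degree `2`) against
a pair of vectors `v, w ∈ V`; this realizes an element of `Λ² V*` as a bilinear form on `V`. -/
noncomputable def asBilinForm {V : Type*} [AddCommGroup V] [Module ℝ V]
    (Ω : ExteriorAlgebra ℝ (Module.Dual ℝ V)) (v w : V) : ℝ :=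
  ExteriorAlgebra.liftAlternating
    (fun i => match i with
      | 2 => evalPair v w
      | _ => 0) Ω

section LefHelpers

variable {V : Type*} [AddCommGroup V] [Module ℝ V]

/-- Contraction with a vector. -/
noncomputable def lefC (v : V) :
    ExteriorAlgebra ℝ (Module.Dual ℝ V) →ₗ[ℝ] ExteriorAlgebra ℝ (Module.Dual ℝ V) :=
  CliffordAlgebra.contractLeft (Q := (0 : QuadraticForm ℝ (Module.Dual ℝ V)))
    (Module.Dual.eval ℝ V v)

theorem lefC_ι_mul (v : V) (a : Module.Dual ℝ V) (x : ExteriorAlgebra ℝ (Module.Dual ℝ V)) :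
    lefC v (ExteriorAlgebra.ι ℝ a * x) = a v • x - ExteriorAlgebra.ι ℝ a * lefC v x :=
  CliffordAlgebra.contractLeft_ι_mul _ _ _

theorem lefC_ι (v : V) (a : Module.Dual ℝ V) :
    lefC v (ExteriorAlgebra.ι ℝ a) = algebraMap ℝ _ (a v) :=
  CliffordAlgebra.contractLeft_ι _ _ _

theorem lefC_one (v : V) : lefC v (1 : ExteriorAlgebra ℝ (Module.Dual ℝ V)) = 0 :=
  CliffordAlgebra.contractLeft_one _ _

theorem lefι_swap (a b : Module.Dual ℝ V) :
    ExteriorAlgebra.ι ℝ a * ExteriorAlgebra.ι ℝ b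
      = - (ExteriorAlgebra.ι ℝ b * ExteriorAlgebra.ι ℝ a) :=
  eq_neg_of_add_eq_zero_left (ExteriorAlgebra.ι_add_mul_swap a b)

/-- Induction principle for degree two elements. -/
theorem lef_two_induction {P : ExteriorAlgebra ℝ (Module.Dual ℝ V) → Prop}
    (h1 : ∀ a b, P (ExteriorAlgebra.ι ℝ a * ExteriorAlgebra.ι ℝ b))
    (h2 : ∀ x y, P x → P y → P (x + y))
    (x : ExteriorAlgebra ℝ (Module.Dual ℝ V)) (hx : x ∈ ⋀[ℝ]^2 (Module.Dual ℝ V)) : P x := by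
  rw [ExteriorAlgebra.exteriorPower, pow_two] at hx
  refine Submodule.mul_induction_on hx ?_ h2
  rintro _ ⟨a, rfl⟩ _ ⟨b, rfl⟩
  exact h1 a b

theorem lef_two_comm (Ω : ExteriorAlgebra ℝ (Module.Dual ℝ V))
    (hΩ : Ω ∈ ⋀[ℝ]^2 (Module.Dual ℝ V)) (c : Module.Dual ℝ V) :
    Ω * ExteriorAlgebra.ι ℝ c = ExteriorAlgebra.ι ℝ c * Ω := by
  refine lef_two_induction (P := fun Ω => Ω * ExteriorAlgebra.ι ℝ c = ExteriorAlgebra.ι ℝ c * Ω)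
    ?_ ?_ Ω hΩ
  · intro a b
    rw [mul_assoc, lefι_swap b c, mul_neg, ← mul_assoc, lefι_swap a c, neg_mul, neg_neg, mul_assoc]
  · intro x y hx hy
    rw [add_mul, mul_add, hx, hy]

theorem lefC_two_mul (Ω : ExteriorAlgebra ℝ (Module.Dual ℝ V))
    (hΩ : Ω ∈ ⋀[ℝ]^2 (Module.Dual ℝ V)) (v : V) (x : ExteriorAlgebra ℝ (Module.Dual ℝ V)) :
    lefC v (Ω * x) = lefC v Ω * x + Ω * lefC v x := by
  refine lef_two_induction (P := fun Ω => lefC v (Ω * x) = lefC v Ω * x + Ω * lefC v x)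
    ?_ ?_ Ω hΩ
  · intro a b
    rw [mul_assoc, lefC_ι_mul, lefC_ι_mul, lefC_ι_mul, lefC_ι, ← Algebra.commutes,
      ← Algebra.smul_def]
    simp only [mul_sub, sub_mul, smul_mul_assoc, mul_smul_comm, mul_assoc]
    abel
  · intro y z hy hz
    simp only [add_mul, map_add, hy, hz]
    abel

theorem lef_asBilinForm_ι (a b : Module.Dual ℝ V) (v w : V) :
    asBilinForm (ExteriorAlgebra.ι ℝ a * ExteriorAlgebra.ι ℝ b) v w = a v * b w - b v * a w := by
  have h : ExteriorAlgebra.ι ℝ a * ExteriorAlgebra.ι ℝ b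
      = ExteriorAlgebra.ιMulti ℝ 2 ![a, b] := by
    simp [ExteriorAlgebra.ιMulti_apply]
  rw [h, asBilinForm, ExteriorAlgebra.liftAlternating_apply_ιMulti]
  have hu : (Finset.univ : Finset (Equiv.Perm (Fin 2))) = {1, Equiv.swap 0 1} := by decide
  have hne : (1 : Equiv.Perm (Fin 2)) ≠ Equiv.swap 0 1 := by decide
  simp only [evalPair, MultilinearMap.alternatization_apply]
  rw [hu, Finset.sum_pair hne]
  simp [Fin.prod_univ_two, Equiv.Perm.sign_swap, sub_eq_add_neg]

theorem lefC_two (Ω : ExteriorAlgebra ℝ (Module.Dual ℝ V))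
    (hΩ : Ω ∈ ⋀[ℝ]^2 (Module.Dual ℝ V)) (v : V) :
    ∃ f : Module.Dual ℝ V, lefC v Ω = ExteriorAlgebra.ι ℝ f ∧ ∀ w, f w = asBilinForm Ω v w := by
  refine lef_two_induction (P := fun Ω => ∃ f : Module.Dual ℝ V,
    lefC v Ω = ExteriorAlgebra.ι ℝ f ∧ ∀ w, f w = asBilinForm Ω v w) ?_ ?_ Ω hΩ
  · intro a b
    refine ⟨a v • b - b v • a, ?_, fun w => ?_⟩
    · rw [lefC_ι_mul, lefC_ι, ← Algebra.commutes, ← Algebra.smul_def, map_sub, map_smul, map_smul]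
    · rw [lef_asBilinForm_ι]; simp
  · rintro x y ⟨f, hf, hf'⟩ ⟨g, hg, hg'⟩
    refine ⟨f + g, by rw [map_add, map_add, hf, hg], fun w => ?_⟩
    rw [LinearMap.add_apply, hf', hg']
    simp [asBilinForm]

theorem lefC_pow_mul (Ω : ExteriorAlgebra ℝ (Module.Dual ℝ V))
    (hΩ : Ω ∈ ⋀[ℝ]^2 (Module.Dual ℝ V)) (v : V) (n : ℕ)
    (x : ExteriorAlgebra ℝ (Module.Dual ℝ V)) :
    lefC v (Ω ^ (n + 1) * x)
      = ((n : ℝ) + 1) • (lefC v Ω * (Ω ^ n * x)) + Ω ^ (n + 1) * lefC v x := by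
  obtain ⟨f, hf, -⟩ := lefC_two Ω hΩ v
  have hc := lef_two_comm Ω hΩ f
  rw [hf]
  induction n with
  | zero => simp [lefC_two_mul Ω hΩ, hf]
  | succ n ih =>
    rw [pow_succ', mul_assoc, lefC_two_mul Ω hΩ, ih, hf, mul_add, mul_smul_comm, ← mul_assoc Ω,
      hc, mul_assoc _ Ω, ← mul_assoc Ω (Ω ^ n), ← pow_succ', ← mul_assoc Ω, ← pow_succ']
    push_cast
    rw [← add_assoc]
    congr 1
    module

theorem lefC_mem (v : V) (k : ℕ) : ∀ x ∈ ⋀[ℝ]^(k + 1) (Module.Dual ℝ V),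
    lefC v x ∈ ⋀[ℝ]^k (Module.Dual ℝ V) := by
  induction k with
  | zero =>
    intro x hx
    simp only [ExteriorAlgebra.exteriorPower, zero_add, pow_one, pow_zero] at hx ⊢
    obtain ⟨a, rfl⟩ := hx
    rw [lefC_ι]
    exact Submodule.algebraMap_mem _
  | succ k ih =>
    intro x hx
    rw [ExteriorAlgebra.exteriorPower, pow_succ'] at hx
    refine Submodule.mul_induction_on hx ?_ ?_
    · rintro _ ⟨a, rfl⟩ y hy
      rw [lefC_ι_mul]
      refine Submodule.sub_mem _ (Submodule.smul_mem _ _ hy) ?_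
      rw [ExteriorAlgebra.exteriorPower, pow_succ']
      exact Submodule.mul_mem_mul ⟨a, rfl⟩ (ih y hy)
    · intro y z hy hz
      rw [map_add]
      exact Submodule.add_mem _ hy hz

theorem lef_euler {ι : Type*} [Fintype ι] [DecidableEq ι] (b : Module.Basis ι ℝ V) (k : ℕ) :
    ∀ x ∈ ⋀[ℝ]^k (Module.Dual ℝ V),
    ∑ i, ExteriorAlgebra.ι ℝ (b.dualBasis i) * lefC (b i) x = (k : ℝ) • x := by
  induction k with
  | zero =>
    intro x hx
    simp only [ExteriorAlgebra.exteriorPower, pow_zero] at hx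
    obtain ⟨r, rfl⟩ := Submodule.mem_one.1 hx
    simp [Algebra.algebraMap_eq_smul_one, lefC_one]
  | succ k ih =>
    intro x hx
    rw [ExteriorAlgebra.exteriorPower, pow_succ'] at hx
    refine Submodule.mul_induction_on hx ?_ ?_
    · rintro _ ⟨a, rfl⟩ y hy
      have h1 : ∑ i, a (b i) • b.dualBasis i = a := by
        apply b.ext
        intro j
        simp [Module.Basis.dualBasis_apply, Finsupp.single_apply]
      have h2 : ∀ i, ExteriorAlgebra.ι ℝ (b.dualBasis i) * lefC (b i) (ExteriorAlgebra.ι ℝ a * y)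
          = ExteriorAlgebra.ι ℝ (a (b i) • b.dualBasis i) * y
            + ExteriorAlgebra.ι ℝ a * (ExteriorAlgebra.ι ℝ (b.dualBasis i) * lefC (b i) y) := by
        intro i
        rw [lefC_ι_mul, mul_sub, ← mul_assoc, lefι_swap, map_smul, mul_smul_comm, smul_mul_assoc,
          neg_mul, sub_neg_eq_add, mul_assoc]
      rw [Finset.sum_congr rfl (fun i _ => h2 i), Finset.sum_add_distrib, ← Finset.sum_mul,
        ← map_sum, h1, ← Finset.mul_sum, ih y hy, mul_smul_comm]
      push_cast
      module
    · intro y z hy hz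
      simp only [map_add, mul_add, Finset.sum_add_distrib, hy, hz, smul_add]

theorem lef_eq_zero_of_contract [FiniteDimensional ℝ V] (k : ℕ)
    (x : ExteriorAlgebra ℝ (Module.Dual ℝ V)) (hx : x ∈ ⋀[ℝ]^(k + 1) (Module.Dual ℝ V))
    (h : ∀ v, lefC v x = 0) : x = 0 := by
  have := lef_euler (Module.finBasis ℝ V) (k + 1) x hx
  simp only [h, mul_zero, Finset.sum_const_zero] at this
  rcases smul_eq_zero.1 this.symm with h | h
  · exact absurd h (by positivity)
  · exact h

theorem lef_eq_zero_of_mul [FiniteDimensional ℝ V] (k : ℕ) (hk : k < Module.finrank ℝ V)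
    (x : ExteriorAlgebra ℝ (Module.Dual ℝ V)) (hx : x ∈ ⋀[ℝ]^k (Module.Dual ℝ V))
    (h : ∀ a, ExteriorAlgebra.ι ℝ a * x = 0) : x = 0 := by
  have h1 := lef_euler (Module.finBasis ℝ V) k x hx
  have h2 : ∀ i, ExteriorAlgebra.ι ℝ ((Module.finBasis ℝ V).dualBasis i)
      * lefC (Module.finBasis ℝ V i) x = x := by
    intro i
    have := lefC_ι_mul (Module.finBasis ℝ V i) ((Module.finBasis ℝ V).dualBasis i) x
    rw [h, map_zero] at this
    rw [← sub_eq_zero.1 this.symm]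
    simp
  rw [Finset.sum_congr rfl (fun i _ => h2 i), Finset.sum_const, Finset.card_univ,
    Fintype.card_fin, ← Nat.cast_smul_eq_nsmul ℝ, ← sub_eq_zero, ← sub_smul] at h1
  rcases smul_eq_zero.1 h1 with h | h
  · exact absurd (Nat.cast_injective (sub_eq_zero.1 h)) hk.ne'
  · exact h

theorem lef_pow_mem (Ω : ExteriorAlgebra ℝ (Module.Dual ℝ V))
    (hΩ : Ω ∈ ⋀[ℝ]^2 (Module.Dual ℝ V)) (r : ℕ) :
    Ω ^ r ∈ ⋀[ℝ]^(2 * r) (Module.Dual ℝ V) := by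
  rw [ExteriorAlgebra.exteriorPower, pow_mul]
  exact Submodule.pow_mem_pow _ hΩ r

theorem lef_pow_ne_zero [FiniteDimensional ℝ V] (m : ℕ) (hdim : Module.finrank ℝ V = 2 * m)
    (Ω : ExteriorAlgebra ℝ (Module.Dual ℝ V))
    (hΩ : Ω ∈ ⋀[ℝ]^2 (Module.Dual ℝ V))
    (hs : ∀ a : Module.Dual ℝ V, ∃ v, lefC v Ω = ExteriorAlgebra.ι ℝ a) (r : ℕ) (hr : r ≤ m) :
    Ω ^ r ≠ 0 := by
  induction r with
  | zero => simp
  | succ r ih =>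
    intro h0
    refine ih (by omega) (lef_eq_zero_of_mul (2 * r) (by omega) _ (lef_pow_mem Ω hΩ r) ?_)
    intro a
    obtain ⟨v, hv⟩ := hs a
    have := lefC_pow_mul Ω hΩ v r 1
    rw [h0, zero_mul, map_zero, zero_mul, add_zero, mul_one, hv] at this
    rcases smul_eq_zero.1 this.symm with h | h
    · exact absurd h (by positivity)
    · exact h

theorem lef_inj [FiniteDimensional ℝ V] (m : ℕ) (hdim : Module.finrank ℝ V = 2 * m)
    (Ω : ExteriorAlgebra ℝ (Module.Dual ℝ V))
    (hΩ : Ω ∈ ⋀[ℝ]^2 (Module.Dual ℝ V))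
    (hs : ∀ a : Module.Dual ℝ V, ∃ v, lefC v Ω = ExteriorAlgebra.ι ℝ a) (k : ℕ) (hk : k ≤ m) :
    ∀ x ∈ ⋀[ℝ]^k (Module.Dual ℝ V), Ω ^ (m - k) * x = 0 → x = 0 := by
  induction k with
  | zero =>
    intro x hx h
    simp only [ExteriorAlgebra.exteriorPower, pow_zero] at hx
    obtain ⟨r, rfl⟩ := Submodule.mem_one.1 hx
    rw [← Algebra.commutes, ← Algebra.smul_def] at h
    rcases smul_eq_zero.1 h with h | h
    · rw [h, map_zero]
    · exact absurd h (lef_pow_ne_zero m hdim Ω hΩ hs _ (by omega))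
  | succ k ih =>
    intro x hx h
    refine lef_eq_zero_of_contract k x hx fun v => ?_
    refine ih (by omega) _ (lefC_mem v k x hx) ?_
    have hmk : m - k = (m - (k + 1)) + 1 := by omega
    have := lefC_pow_mul Ω hΩ v (m - (k + 1)) x
    rw [h, mul_zero, smul_zero, zero_add, pow_succ', mul_assoc, h, mul_zero, map_zero,
      ← pow_succ', ← hmk] at this
    exact this.symm

end LefHelpers

/-- hard Lefschetz: if `dim V = 2m`, `m ≥ 1`, and `ω` is a nondegenerate
alternating bilinear form on `V` regarded as `Ω ∈ Λ²V*`, then for every `0 ≤ k ≤ m`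
the linear map `Λ^k V* → Λ^{2m-k} V*`, `α ↦ ω^{m-k} ∧ α` (exterior multiplication by the
`(m-k)`-th exterior power of `ω`), is a linear isomorphism (injective and onto
`Λ^{2m-k} V*`). -/
theorem lefschetz_power_bijective {V : Type*} [AddCommGroup V] [Module ℝ V]
    [FiniteDimensional ℝ V] (m : ℕ) (hm : 1 ≤ m)
    (hdim : Module.finrank ℝ V = 2 * m)
    (ω : V →ₗ[ℝ] V →ₗ[ℝ] ℝ)
    (halt : ∀ v : V, ω v v = 0)
    (hnondeg : ∀ v : V, (∀ w : V, ω v w = 0) → v = 0)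
    (Ω : ⋀[ℝ]^2 (Module.Dual ℝ V))
    (hΩ : ∀ v w : V, asBilinForm (Ω : ExteriorAlgebra ℝ (Module.Dual ℝ V)) v w = ω v w)
    (k : ℕ) (hk : k ≤ m) :
    Function.Injective (fun α : ⋀[ℝ]^k (Module.Dual ℝ V) =>
      (Ω : ExteriorAlgebra ℝ (Module.Dual ℝ V)) ^ (m - k)
        * (α : ExteriorAlgebra ℝ (Module.Dual ℝ V)))
    ∧ ∀ γ : ⋀[ℝ]^(2 * m - k) (Module.Dual ℝ V), ∃ α : ⋀[ℝ]^k (Module.Dual ℝ V),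
      (Ω : ExteriorAlgebra ℝ (Module.Dual ℝ V)) ^ (m - k)
        * (α : ExteriorAlgebra ℝ (Module.Dual ℝ V))
        = (γ : ExteriorAlgebra ℝ (Module.Dual ℝ V)) := by
  have hsurj : Function.Surjective (ω : V →ₗ[ℝ] Module.Dual ℝ V) := by
    refine (LinearMap.injective_iff_surjective_of_finrank_eq_finrank
      (Subspace.dual_finrank_eq (K := ℝ) (V := V)).symm).1 ?_
    refine (injective_iff_map_eq_zero ω).2 fun v hv => hnondeg v fun w => ?_
    rw [hv, LinearMap.zero_apply]
  have hs : ∀ a : Module.Dual ℝ V, ∃ v,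
      lefC v (Ω : ExteriorAlgebra ℝ (Module.Dual ℝ V)) = ExteriorAlgebra.ι ℝ a := by
    intro a
    obtain ⟨v, rfl⟩ := hsurj a
    obtain ⟨f, hf, hf'⟩ := lefC_two _ Ω.2 v
    refine ⟨v, hf.trans (congrArg _ ?_)⟩
    ext w
    rw [hf', hΩ]
  have hmem : ∀ α : ⋀[ℝ]^k (Module.Dual ℝ V),
      (Ω : ExteriorAlgebra ℝ (Module.Dual ℝ V)) ^ (m - k)
        * (α : ExteriorAlgebra ℝ (Module.Dual ℝ V)) ∈ ⋀[ℝ]^(2 * m - k) (Module.Dual ℝ V) := by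
    intro α
    have h : 2 * m - k = 2 * (m - k) + k := by omega
    rw [h, ExteriorAlgebra.exteriorPower, pow_add]
    exact Submodule.mul_mem_mul (lef_pow_mem _ Ω.2 _) α.2
  let L : ⋀[ℝ]^k (Module.Dual ℝ V) →ₗ[ℝ] ⋀[ℝ]^(2 * m - k) (Module.Dual ℝ V) :=
    LinearMap.codRestrict _
      ((LinearMap.mulLeft ℝ ((Ω : ExteriorAlgebra ℝ (Module.Dual ℝ V)) ^ (m - k))).comp
        (Submodule.subtype _)) hmem
  have hL : Function.Injective L := by
    refine (injective_iff_map_eq_zero L).2 fun α hα => Subtype.ext ?_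
    exact lef_inj m hdim _ Ω.2 hs k hk α α.2 (congrArg Subtype.val hα)
  have hfr : Module.finrank ℝ (⋀[ℝ]^k (Module.Dual ℝ V))
      = Module.finrank ℝ (⋀[ℝ]^(2 * m - k) (Module.Dual ℝ V)) := by
    rw [exteriorPower.finrank_eq, exteriorPower.finrank_eq, Subspace.dual_finrank_eq, hdim,
      Nat.choose_symm (by omega)]
  refine ⟨fun α β h => hL (Subtype.ext h), fun γ => ?_⟩
  obtain ⟨α, hα⟩ := (LinearMap.injective_iff_surjective_of_finrank_eq_finrank hfr).1 hL γ
  exact ⟨α, congrArg Subtype.val hα⟩
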